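/- For every real number x with 0 < |x| < 1, the digamma function satisfies ψ(1+x) + ψ(1−x) + 2γ = −2x² ∑_{n=1}^∞ 1/(n(n² − x²)), where γ is the Euler–Mascheroni constant. -/

import Mathlib

/-- The digamma function `ψ(x) = Γ'(x)/Γ(x)`. -/
noncomputable def digamma (x : ℝ) : ℝ := deriv Real.Gamma x / Real.Gamma x

open Filter Topology Finset

lemma Real.differentiableAt_Gamma_of_pos {x : ℝ} (hx : 0 < x) : DifferentiableAt ℝ Real.Gamma x :=
  Real.differentiableAt_Gamma fun m ↦ ((neg_nonpos.mpr m.cast_nonneg).trans_lt hx).ne'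

lemma hasDerivAt_log_Gamma {x : ℝ} (hx : 0 < x) :
    HasDerivAt (Real.log ∘ Real.Gamma) (digamma x) x :=
  (Real.differentiableAt_Gamma_of_pos hx).hasDerivAt.log (Real.Gamma_pos_of_pos hx).ne'

lemma slope_log_Gamma_add_one {x : ℝ} (hx : 0 < x) :
    slope (Real.log ∘ Real.Gamma) x (x + 1) = Real.log x := by
  rw [slope_def_field, add_sub_cancel_left, div_one, Function.comp_apply, Function.comp_apply,
    Real.Gamma_add_one hx.ne', Real.log_mul hx.ne' (Real.Gamma_pos_of_pos hx).ne',
    add_sub_cancel_right]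

lemma digamma_add_one {x : ℝ} (hx : 0 < x) : digamma (x + 1) = digamma x + 1 / x := by
  have h₁ := (hasDerivAt_log_Gamma (add_pos hx one_pos)).comp_add_const x 1
  have h₂ := (hasDerivAt_log_Gamma hx).add (Real.hasDerivAt_log hx.ne')
  rw [one_div]
  refine h₁.unique (h₂.congr_of_eventuallyEq ?_)
  filter_upwards [eventually_gt_nhds hx] with y hy
  have := slope_log_Gamma_add_one hy
  rw [slope_def_field, add_sub_cancel_left, div_one] at this
  simp only [Pi.add_apply]
  linarith

lemma digamma_le_log {x : ℝ} (hx : 0 < x) : digamma x ≤ Real.log x := by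
  rw [← slope_log_Gamma_add_one hx]
  exact Real.convexOn_log_Gamma.le_slope_of_hasDerivAt hx (add_pos hx one_pos)
    (lt_add_one x) (hasDerivAt_log_Gamma hx)

lemma log_sub_one_div_le_digamma {x : ℝ} (hx : 0 < x) : Real.log x - 1 / x ≤ digamma x := by
  rw [sub_le_iff_le_add, ← digamma_add_one hx, ← slope_log_Gamma_add_one hx]
  exact Real.convexOn_log_Gamma.slope_le_of_hasDerivAt hx (add_pos hx one_pos)
    (lt_add_one x) (hasDerivAt_log_Gamma (add_pos hx one_pos))

lemma digamma_add_nat {x : ℝ} (hx : 0 < x) (N : ℕ) :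
    digamma (x + N) = digamma x + ∑ n ∈ range N, 1 / (x + n) := by
  induction N with
  | zero => simp
  | succ N ih =>
    rw [sum_range_succ, ← add_assoc, ← ih, ← digamma_add_one (by positivity), Nat.cast_add_one,
      add_assoc]

lemma tendsto_digamma_add_nat_sub_log {x : ℝ} (hx : 0 < x) :
    Tendsto (fun N : ℕ ↦ digamma (x + N) - Real.log N) atTop (𝓝 0) := by
  have h_log : Tendsto (fun N : ℕ ↦ Real.log (x + N) - Real.log N) atTop (𝓝 0) := by
    simpa only [Function.comp_def, add_comm] using
      (Real.tendsto_log_comp_add_sub_log x).comp tendsto_natCast_atTop_atTop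
  have h_inv : Tendsto (fun N : ℕ ↦ 1 / (x + N)) atTop (𝓝 0) :=
    tendsto_const_nhds.div_atTop (tendsto_atTop_add_const_left _ x tendsto_natCast_atTop_atTop)
  refine tendsto_of_tendsto_of_tendsto_of_le_of_le
    (by simpa only [sub_zero] using h_log.sub h_inv) h_log
    (fun N ↦ ?_) (fun N ↦ ?_)
  · have := log_sub_one_div_le_digamma (show 0 < x + N by positivity)
    beta_reduce
    linarith
  · exact sub_le_sub_right (digamma_le_log (by positivity)) _

/-- Euler's limit formula for the digamma function. -/
lemma tendsto_log_sub_sum_digamma {x : ℝ} (hx : 0 < x) :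
    Tendsto (fun N : ℕ ↦ Real.log N - ∑ n ∈ range N, 1 / (x + n)) atTop (𝓝 (digamma x)) := by
  have h := (tendsto_digamma_add_nat_sub_log hx).const_sub (digamma x)
  rw [sub_zero] at h
  refine h.congr fun N ↦ ?_
  rw [digamma_add_nat hx]
  ring

lemma hasSum_digamma_one_add_add_digamma_one_sub {x : ℝ} (hx : |x| < 1) :
    HasSum (fun n : ℕ ↦ 2 * x ^ 2 * (1 / (((n + 1 : ℕ) : ℝ) * (((n + 1 : ℕ) : ℝ) ^ 2 - x ^ 2))))
      (-(digamma (1 + x) + digamma (1 - x) + 2 * Real.eulerMascheroniConstant)) := by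
  obtain ⟨hx₁, hx₂⟩ := abs_lt.mp hx
  have h_pos₁ (n : ℕ) : 0 < 1 + x + n := by linarith [n.cast_nonneg (α := ℝ)]
  have h_pos₂ (n : ℕ) : 0 < 1 - x + n := by linarith [n.cast_nonneg (α := ℝ)]
  have h_factor (n : ℕ) : ((n + 1 : ℕ) : ℝ) ^ 2 - x ^ 2 = (1 + x + n) * (1 - x + n) := by
    push_cast
    ring
  rw [hasSum_iff_tendsto_nat_of_nonneg fun n ↦ by
    rw [h_factor]
    have := h_pos₁ n
    have := h_pos₂ n
    positivity]
  refine (((tendsto_log_sub_sum_digamma (show 0 < 1 + x by linarith)).add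
    (tendsto_log_sub_sum_digamma (show 0 < 1 - x by linarith))).add
    (Real.tendsto_harmonic_sub_log.const_mul 2)).neg.congr fun N ↦ ?_
  have h_sum : ∑ n ∈ range N, 2 * x ^ 2 *
      (1 / (((n + 1 : ℕ) : ℝ) * (((n + 1 : ℕ) : ℝ) ^ 2 - x ^ 2))) =
      ∑ n ∈ range N, 1 / (1 + x + n) + ∑ n ∈ range N, 1 / (1 - x + n) - 2 * (harmonic N : ℝ) := by
    rw [harmonic, Rat.cast_sum, mul_sum, ← sum_add_distrib, ← sum_sub_distrib]
    refine sum_congr rfl fun n _ ↦ ?_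
    have := (h_pos₁ n).ne'
    have := (h_pos₂ n).ne'
    rw [h_factor]
    push_cast
    field_simp
    ring
  rw [h_sum]
  ring

theorem digamma_one_add_add_digamma_one_sub (x : ℝ) (hx : 0 < |x|) (hx' : |x| < 1) :
    digamma (1 + x) + digamma (1 - x) + 2 * Real.eulerMascheroniConstant =
      -2 * x ^ 2 * ∑' n : ℕ+, 1 / ((n : ℝ) * ((n : ℝ) ^ 2 - x ^ 2)) := by
  have h := (hasSum_digamma_one_add_add_digamma_one_sub hx').tsum_eq
  rw [tsum_mul_left] at h
  rw [tsum_pnat_eq_tsum_succ (f := fun n : ℕ ↦ 1 / ((n : ℝ) * ((n : ℝ) ^ 2 - x ^ 2)))]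
  linarith
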